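/- The functions Q_n^{j,k} form an orthonormal family in L²(B₃): for all integers n, m ≥ 0 and indices j, k, j′, k′ ≥ 0 with j + k ≤ n and j′ + k′ ≤ m, ∫_{B₃} Q_n^{j,k}(x,y,z)·Q_m^{j′,k′}(x,y,z) dx dy dz = 1 if (n,j,k) = (m,j′,k′), and = 0 otherwise. -/

import Mathlib

open MeasureTheory Real Filter

/-- The Gegenbauer polynomials `C_n^λ`, defined by their triple recursion. -/
noncomputable def gegenbauer (lam : ℝ) : ℕ → ℝ → ℝ
  | 0, _ => 1
  | 1, t => 2 * lam * t
  | (n + 2), t =>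
      (2 * (((n : ℝ) + 1) + lam) / ((n : ℝ) + 2)) * t * gegenbauer lam (n + 1) t
        - ((((n : ℝ) + 1) + 2 * lam - 1) / ((n : ℝ) + 2)) * gegenbauer lam n t

/-- The open unit ball in `ℝ³`. -/
def unitBall3 : Set (ℝ × ℝ × ℝ) := {p | p.1 ^ 2 + p.2.1 ^ 2 + p.2.2 ^ 2 < 1}

/-- `(N_m^{[μ]})²`, the squared weighted `L²`-norm of the Gegenbauer
polynomial `C_m^μ`. -/
noncomputable def Nsq (mu : ℝ) (m : ℕ) : ℝ :=
  π * Real.Gamma (2 * mu + m) /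
    ((2 : ℝ) ^ (2 * mu - 1) * (Nat.factorial m : ℝ) * (mu + m) * Real.Gamma mu ^ 2)

/-- The normalization constant `h_{j,k,n}`. -/
noncomputable def h3 (j k n : ℕ) : ℝ :=
  Real.sqrt (Nsq (1 / 2) k * Nsq ((k : ℝ) + 1) j *
    Nsq ((j : ℝ) + (k : ℝ) + 3 / 2) (n - j - k))

/-- The orthonormal polynomial basis `Q_n^{j,k}` on the unit ball. -/
noncomputable def Q3 (n j k : ℕ) (x y z : ℝ) : ℝ :=
  (1 / h3 j k n) * gegenbauer ((j : ℝ) + (k : ℝ) + 3 / 2) (n - j - k) x *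
    (1 - x ^ 2) ^ ((j : ℝ) / 2) * gegenbauer ((k : ℝ) + 1) j (y / Real.sqrt (1 - x ^ 2)) *
    (1 - x ^ 2 - y ^ 2) ^ ((k : ℝ) / 2) *
    gegenbauer (1 / 2) k (z / Real.sqrt (1 - x ^ 2 - y ^ 2))

section Gegenbauer

variable (lam : ℝ)

theorem gegenbauer_zero (t : ℝ) : gegenbauer lam 0 t = 1 := by simp [gegenbauer]

theorem gegenbauer_one (t : ℝ) : gegenbauer lam 1 t = 2 * lam * t := by simp [gegenbauer]

theorem gegenbauer_add_two (n : ℕ) (t : ℝ) :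
    ((n : ℝ) + 2) * gegenbauer lam (n + 2) t =
      2 * ((n : ℝ) + 1 + lam) * (t * gegenbauer lam (n + 1) t)
        - ((n : ℝ) + 2 * lam) * gegenbauer lam n t := by
  have : (n : ℝ) + 2 ≠ 0 := by positivity
  rw [gegenbauer]
  field_simp
  ring

theorem differentiable_gegenbauer : ∀ n : ℕ, Differentiable ℝ (gegenbauer lam n)
  | 0 => by
    have : gegenbauer lam 0 = fun _ => 1 := funext (gegenbauer_zero lam)
    rw [this]; fun_prop
  | 1 => by
    have : gegenbauer lam 1 = fun t => 2 * lam * t := funext (gegenbauer_one lam)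
    rw [this]; fun_prop
  | n + 2 => by
    have h₀ := differentiable_gegenbauer n
    have h₁ := differentiable_gegenbauer (n + 1)
    have : gegenbauer lam (n + 2) = fun t =>
        (2 * (((n : ℝ) + 1) + lam) / ((n : ℝ) + 2)) * t * gegenbauer lam (n + 1) t
          - ((((n : ℝ) + 1) + 2 * lam - 1) / ((n : ℝ) + 2)) * gegenbauer lam n t := by
      funext t; rw [gegenbauer]
    rw [this]; fun_prop

theorem continuous_gegenbauer (n : ℕ) : Continuous (gegenbauer lam n) :=
  (differentiable_gegenbauer lam n).continuous

theorem deriv_gegenbauer_add_two (n : ℕ) (t : ℝ) :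
    ((n : ℝ) + 2) * deriv (gegenbauer lam (n + 2)) t =
      2 * ((n : ℝ) + 1 + lam) *
          (gegenbauer lam (n + 1) t + t * deriv (gegenbauer lam (n + 1)) t)
        - ((n : ℝ) + 2 * lam) * deriv (gegenbauer lam n) t := by
  have h (i : ℕ) := (differentiable_gegenbauer lam i t).hasDerivAt
  have h₁ := (h (n + 2)).const_mul ((n : ℝ) + 2)
  have h₂ := (((hasDerivAt_id t).mul (h (n + 1))).const_mul (2 * ((n : ℝ) + 1 + lam))).sub
    ((h n).const_mul ((n : ℝ) + 2 * lam))
  have h₃ : (fun t => ((n : ℝ) + 2) * gegenbauer lam (n + 2) t) = _ :=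
    funext (gegenbauer_add_two lam n)
  rw [h₃] at h₁
  simpa using h₁.unique h₂

/-- The relation `(1 - t²) dC_n/dt = (n + 2λ) t C_n - (n + 1) C_{n+1}`. -/
theorem one_sub_sq_mul_deriv_gegenbauer (t : ℝ) : ∀ n : ℕ,
    (1 - t ^ 2) * deriv (gegenbauer lam n) t =
      ((n : ℝ) + 2 * lam) * (t * gegenbauer lam n t) - ((n : ℝ) + 1) * gegenbauer lam (n + 1) t
  | 0 => by
    have : gegenbauer lam 0 = fun _ => 1 := funext (gegenbauer_zero lam)
    simp [this, gegenbauer_one]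
  | 1 => by
    have : gegenbauer lam 1 = fun t => 2 * lam * t := funext (gegenbauer_one lam)
    have h := gegenbauer_add_two lam 0 t
    have hd : deriv (fun t : ℝ => 2 * lam * t) t = 2 * lam := by
      simp
    simp only [zero_add, gegenbauer_one, gegenbauer_zero] at h
    rw [this, hd]
    norm_num at h ⊢
    linear_combination h
  | n + 2 => by
    have i₀ := one_sub_sq_mul_deriv_gegenbauer t n
    have i₁ := one_sub_sq_mul_deriv_gegenbauer t (n + 1)
    have h₂ := gegenbauer_add_two lam n t
    have h₃ := gegenbauer_add_two lam (n + 1) t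
    have hd := deriv_gegenbauer_add_two lam n t
    have hn : (n : ℝ) + 2 ≠ 0 := by positivity
    apply mul_left_cancel₀ hn
    push_cast at *
    linear_combination (1 - t ^ 2) * hd + 2 * ((n : ℝ) + 1 + lam) * t * i₁
      - ((n : ℝ) + 2 * lam) * i₀ + ((n : ℝ) + 2) * h₃ - (n + 2 * lam) * t * h₂

/-- The integral of `f` over `[-1, 1]` against the Gegenbauer weight `(1 - t²)^(λ - 1/2)`. -/
noncomputable def gegenbauerIntegral (f : ℝ → ℝ) : ℝ :=
  ∫ t in (-1)..1, (1 - t ^ 2) ^ (lam - 1 / 2) * f t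

variable {lam}

theorem intervalIntegrable_gegenbauerWeight_mul (hlam : 1 / 2 ≤ lam) {f : ℝ → ℝ}
    (hf : Continuous f) :
    IntervalIntegrable (fun t => (1 - t ^ 2) ^ (lam - 1 / 2) * f t) volume (-1) 1 := by
  apply Continuous.intervalIntegrable
  refine Continuous.mul (Continuous.rpow_const (by fun_prop) fun _ => Or.inr (by linarith)) hf

theorem gegenbauerIntegral_add (hlam : 1 / 2 ≤ lam) {f g : ℝ → ℝ}
    (hf : Continuous f) (hg : Continuous g) (a b : ℝ) :
    gegenbauerIntegral lam (fun t => a * f t + b * g t) =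
      a * gegenbauerIntegral lam f + b * gegenbauerIntegral lam g := by
  unfold gegenbauerIntegral
  rw [← intervalIntegral.integral_const_mul, ← intervalIntegral.integral_const_mul,
    ← intervalIntegral.integral_add
      ((intervalIntegrable_gegenbauerWeight_mul hlam hf).const_mul a)
      ((intervalIntegrable_gegenbauerWeight_mul hlam hg).const_mul b)]
  congr 1
  funext t
  ring

/-- Integration by parts against the Gegenbauer weight. -/
theorem gegenbauerIntegral_deriv (hlam : 1 / 2 ≤ lam) {f f' : ℝ → ℝ}
    (hf : ∀ t, HasDerivAt f (f' t) t) {g : ℝ → ℝ} (hg : Continuous g)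
    (hfg : ∀ t, (1 - t ^ 2) * f' t - (2 * lam + 1) * t * f t = g t) :
    gegenbauerIntegral lam g = 0 := by
  have key : ∀ t ∈ Set.uIcc (-1 : ℝ) 1,
      HasDerivAt (fun t => (1 - t ^ 2) ^ (lam + 1 / 2) * f t)
        ((1 - t ^ 2) ^ (lam - 1 / 2) * g t) t := by
    intro t ht
    rw [Set.uIcc_of_le (by norm_num)] at ht
    have h0 : 0 ≤ 1 - t ^ 2 := by nlinarith [ht.1, ht.2]
    have h1 : HasDerivAt (fun t : ℝ => 1 - t ^ 2) (-(2 * t)) t := by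
      simpa using (hasDerivAt_pow 2 t).const_sub 1
    have h2 := (h1.rpow_const (p := lam + 1 / 2) (Or.inr (by linarith))).mul (hf t)
    refine h2.congr_deriv ?_
    have h3 : (1 - t ^ 2) ^ (lam + 1 / 2) = (1 - t ^ 2) ^ (lam - 1 / 2) * (1 - t ^ 2) := by
      rw [← Real.rpow_add_one' h0 (by linarith)]
      congr 1; ring
    have h4 : lam + 1 / 2 - 1 = lam - 1 / 2 := by ring
    rw [h3, h4, ← hfg t]
    ring
  rw [gegenbauerIntegral, intervalIntegral.integral_eq_sub_of_hasDerivAt key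
    (intervalIntegrable_gegenbauerWeight_mul hlam hg)]
  have : lam + 2⁻¹ ≠ 0 := by linarith
  simp [Real.zero_rpow this]

theorem gegenbauerIntegral_gegenbauer (hlam : 1 / 2 ≤ lam) : ∀ n : ℕ,
    gegenbauerIntegral lam (gegenbauer lam (n + 1)) = 0
  | 0 => gegenbauerIntegral_deriv hlam (f := fun _ => -(2 * lam) / (2 * lam + 1))
      (fun t => hasDerivAt_const t _) (continuous_gegenbauer lam 1) fun t => by
        have : 2 * lam + 1 ≠ 0 := by linarith
        rw [zero_add, gegenbauer_one]
        field_simp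
        ring
  | n + 1 => by
    have hc (i : ℕ) := continuous_gegenbauer lam i
    have hpos : (0 : ℝ) < n + 1 + lam := by positivity
    have h := gegenbauerIntegral_deriv hlam
      (fun t => ((differentiable_gegenbauer lam (n + 1) t).hasDerivAt))
      (g := fun t => -((n + 2) * (n + 2 + 2 * lam) / (2 * (n + 1 + lam))) *
          gegenbauer lam (n + 2) t +
        n * (n + 2 * lam) / (2 * (n + 1 + lam)) * gegenbauer lam n t) (by fun_prop)
      fun t => by
        have h₁ := one_sub_sq_mul_deriv_gegenbauer lam t (n + 1)
        have h₂ := gegenbauer_add_two lam n t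
        push_cast at h₁
        rw [h₁]
        field_simp
        linear_combination -(n : ℝ) * h₂
    rw [gegenbauerIntegral_add hlam (hc _) (hc _)] at h
    have hz : (n : ℝ) * (n + 2 * lam) / (2 * (n + 1 + lam)) *
        gegenbauerIntegral lam (gegenbauer lam n) = 0 := by
      by_cases hn : n = 0
      · simp [hn]
      · have ih := gegenbauerIntegral_gegenbauer hlam (n - 1)
        rw [Nat.sub_add_cancel (Nat.pos_of_ne_zero hn)] at ih
        rw [ih, mul_zero]
    rw [hz, add_zero] at h
    refine (mul_eq_zero.1 h).resolve_left (neg_ne_zero.2 (ne_of_gt ?_))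
    positivity

theorem mul_gegenbauer_succ (hlam : 1 / 2 ≤ lam) (n : ℕ) (t : ℝ) :
    t * gegenbauer lam (n + 1) t =
      ((n : ℝ) + 2) / (2 * (n + 1 + lam)) * gegenbauer lam (n + 2) t +
        ((n : ℝ) + 2 * lam) / (2 * (n + 1 + lam)) * gegenbauer lam n t := by
  have hpos : (0 : ℝ) < n + 1 + lam := by positivity
  have h := gegenbauer_add_two lam n t
  field_simp
  linear_combination -h

/-- The Gegenbauer polynomials are pairwise orthogonal. -/
theorem gegenbauerIntegral_mul_of_lt (hlam : 1 / 2 ≤ lam) : ∀ m n : ℕ, m < n →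
    gegenbauerIntegral lam (fun t => gegenbauer lam m t * gegenbauer lam n t) = 0
  | 0, n + 1, _ => by
    simp only [gegenbauer_zero, one_mul]
    exact gegenbauerIntegral_gegenbauer hlam n
  | 1, n + 2, _ => by
    have hc (i : ℕ) := continuous_gegenbauer lam i
    have hpos : (0 : ℝ) < n + 1 + 1 + lam := by positivity
    have : (fun t => gegenbauer lam 1 t * gegenbauer lam (n + 2) t) = fun t =>
        (2 * lam * ((n + 3) / (2 * (n + 2 + lam)))) * gegenbauer lam (n + 3) t +
          (2 * lam * ((n + 1 + 2 * lam) / (2 * (n + 2 + lam)))) * gegenbauer lam (n + 1) t := by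
      funext t
      have h := mul_gegenbauer_succ hlam (n + 1) t
      rw [gegenbauer_one, mul_assoc, h]
      push_cast
      ring
    rw [this, gegenbauerIntegral_add hlam (hc _) (hc _), gegenbauerIntegral_gegenbauer hlam,
      gegenbauerIntegral_gegenbauer hlam]
    simp
  | m + 2, n + 1, hmn => by
    have hc (i : ℕ) := continuous_gegenbauer lam i
    have i₁ := gegenbauerIntegral_mul_of_lt hlam (m + 1) (n + 2) (by omega)
    have i₂ := gegenbauerIntegral_mul_of_lt hlam (m + 1) n (by omega)
    have i₃ := gegenbauerIntegral_mul_of_lt hlam m (n + 1) (by omega)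
    have : (fun t => gegenbauer lam (m + 2) t * gegenbauer lam (n + 1) t) = fun t =>
        1 * ((2 * (m + 1 + lam) / (m + 2) * ((n + 2) / (2 * (n + 1 + lam)))) *
            (gegenbauer lam (m + 1) t * gegenbauer lam (n + 2) t) +
          (2 * (m + 1 + lam) / (m + 2) * ((n + 2 * lam) / (2 * (n + 1 + lam)))) *
            (gegenbauer lam (m + 1) t * gegenbauer lam n t)) +
        (-((m + 2 * lam) / (m + 2))) * (gegenbauer lam m t * gegenbauer lam (n + 1) t) := by
      funext t
      have h := mul_gegenbauer_succ hlam n t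
      have h' := gegenbauer_add_two lam m t
      have h'' : gegenbauer lam (m + 2) t = 2 * (m + 1 + lam) / (m + 2) *
          (t * gegenbauer lam (m + 1) t) - (m + 2 * lam) / (m + 2) * gegenbauer lam m t := by
        field_simp
        linear_combination h'
      rw [h'']
      linear_combination 2 * (m + 1 + lam) / (m + 2) * gegenbauer lam (m + 1) t * h
    rw [this, gegenbauerIntegral_add hlam (by fun_prop) (by fun_prop),
      gegenbauerIntegral_add hlam (by fun_prop) (by fun_prop), i₁, i₂, i₃]
    simp

theorem gegenbauerIntegral_mul_self_succ (hlam : 1 / 2 ≤ lam) (n : ℕ) :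
    gegenbauerIntegral lam (fun t => gegenbauer lam (n + 1) t * gegenbauer lam (n + 1) t) =
      (n + 2 * lam) * (n + lam) / ((n + 1) * (n + 1 + lam)) *
      gegenbauerIntegral lam (fun t => gegenbauer lam n t * gegenbauer lam n t) := by
  have hc (i : ℕ) := continuous_gegenbauer lam i
  have hpos : (0 : ℝ) < n + lam := by positivity
  have hpos' : (0 : ℝ) < n + 1 + lam := by positivity
  have h₁ : gegenbauerIntegral lam
      (fun t => gegenbauer lam n t * (t * gegenbauer lam (n + 1) t)) =
      (n + 2 * lam) / (2 * (n + 1 + lam)) *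
        gegenbauerIntegral lam (fun t => gegenbauer lam n t * gegenbauer lam n t) := by
    have : (fun t => gegenbauer lam n t * (t * gegenbauer lam (n + 1) t)) = fun t =>
        ((n : ℝ) + 2) / (2 * (n + 1 + lam)) *
            (gegenbauer lam n t * gegenbauer lam (n + 2) t) +
          ((n : ℝ) + 2 * lam) / (2 * (n + 1 + lam)) *
            (gegenbauer lam n t * gegenbauer lam n t) := by
      funext t
      rw [mul_gegenbauer_succ hlam n t]
      ring
    rw [this, gegenbauerIntegral_add hlam (by fun_prop) (by fun_prop),
      gegenbauerIntegral_mul_of_lt hlam n (n + 2) (by omega)]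
    simp
  have h₂ : gegenbauerIntegral lam
      (fun t => gegenbauer lam n t * (t * gegenbauer lam (n + 1) t)) =
      (n + 1) / (2 * (n + lam)) *
        gegenbauerIntegral lam (fun t => gegenbauer lam (n + 1) t * gegenbauer lam (n + 1) t) := by
    rcases n with _ | n
    · have : (fun t => gegenbauer lam 0 t * (t * gegenbauer lam (0 + 1) t)) = fun t =>
          (1 / (2 * lam)) * (gegenbauer lam (0 + 1) t * gegenbauer lam (0 + 1) t) +
            0 * (gegenbauer lam 0 t) := by
        funext t
        simp only [zero_add, gegenbauer_zero, gegenbauer_one]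
        field_simp
        ring
      rw [this, gegenbauerIntegral_add hlam (by fun_prop) (by fun_prop)]
      simp
    · have : (fun t => gegenbauer lam (n + 1) t * (t * gegenbauer lam (n + 1 + 1) t)) = fun t =>
          ((n : ℝ) + 2) / (2 * (n + 1 + lam)) *
              (gegenbauer lam (n + 2) t * gegenbauer lam (n + 2) t) +
            ((n : ℝ) + 2 * lam) / (2 * (n + 1 + lam)) *
              (gegenbauer lam n t * gegenbauer lam (n + 2) t) := by
        funext t
        linear_combination gegenbauer lam (n + 2) t * mul_gegenbauer_succ hlam n t
      rw [this, gegenbauerIntegral_add hlam (by fun_prop) (by fun_prop),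
        gegenbauerIntegral_mul_of_lt hlam n (n + 2) (by omega)]
      push_cast
      ring
  have h := h₂.symm.trans h₁
  rw [div_mul_eq_mul_div, div_mul_eq_mul_div, div_eq_div_iff (by positivity) (by positivity)] at h
  rw [div_mul_eq_mul_div, eq_div_iff (by positivity)]
  linear_combination h / 2

theorem Nsq_succ (hlam : 0 < lam) (n : ℕ) :
    Nsq lam (n + 1) =
      (n + 2 * lam) * (n + lam) / ((n + 1) * (n + 1 + lam)) * Nsq lam n := by
  have hG : Real.Gamma (2 * lam + (n + 1 : ℕ)) = (2 * lam + n) * Real.Gamma (2 * lam + n) := by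
    rw [← Real.Gamma_add_one (by positivity)]
    push_cast
    ring_nf
  have := Real.Gamma_pos_of_pos hlam
  have h2 : (0 : ℝ) < 2 ^ (2 * lam - 1) := by positivity
  have hpos : (0 : ℝ) < lam + n := by positivity
  have hpos' : (0 : ℝ) < n + 1 + lam := by positivity
  have hpos'' : (0 : ℝ) < lam + (n + 1) := by positivity
  unfold Nsq
  rw [hG, Nat.factorial_succ]
  push_cast
  field_simp
  ring

theorem Nsq_pos (hlam : 0 < lam) (n : ℕ) : 0 < Nsq lam n := by
  have := Real.Gamma_pos_of_pos hlam
  have := Real.Gamma_pos_of_pos (show 0 < 2 * lam + n by positivity)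
  unfold Nsq
  positivity

theorem Nsq_add_one_zero (hlam : 0 < lam) :
    Nsq (lam + 1) 0 = (2 * lam + 1) / (2 * lam + 2) * Nsq lam 0 := by
  have hG : Real.Gamma (2 * (lam + 1)) = (2 * lam + 1) * (2 * lam) * Real.Gamma (2 * lam) := by
    rw [mul_assoc, ← Real.Gamma_add_one (by positivity), ← Real.Gamma_add_one (by positivity)]
    ring_nf
  have h2 : (2 : ℝ) ^ (2 * (lam + 1) - 1) = 4 * 2 ^ (2 * lam - 1) := by
    rw [show 2 * (lam + 1) - 1 = (2 * lam - 1) + 2 by ring, Real.rpow_add (by norm_num)]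
    norm_num
    ring
  have := Real.Gamma_pos_of_pos hlam
  have h3 : (0 : ℝ) < 2 ^ (2 * lam - 1) := by positivity
  unfold Nsq
  simp only [Nat.cast_zero, add_zero]
  rw [hG, h2, Real.Gamma_add_one hlam.ne']
  simp only [Nat.factorial_zero, Nat.cast_one]
  field_simp
  ring

theorem gegenbauerIntegral_one_add_one (hlam : 1 / 2 ≤ lam) :
    gegenbauerIntegral (lam + 1) (fun _ => 1) =
      (2 * lam + 1) / (2 * lam + 2) * gegenbauerIntegral lam (fun _ => 1) := by
  have h₁ : gegenbauerIntegral (lam + 1) (fun _ => 1) =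
      gegenbauerIntegral lam (fun t => 1 - t ^ 2) := by
    apply intervalIntegral.integral_congr
    intro t ht
    rw [Set.uIcc_of_le (by norm_num)] at ht
    have h0 : 0 ≤ 1 - t ^ 2 := by nlinarith [ht.1, ht.2]
    simp only
    rw [← Real.rpow_add_one' h0 (by linarith), mul_one]
    congr 1; ring
  have h₂ := gegenbauerIntegral_deriv hlam (f := fun t => t) (fun t => hasDerivAt_id' t)
    (g := fun t => (2 * lam + 2) * (1 - t ^ 2) + (-(2 * lam + 1)) * 1) (by fun_prop)
    fun t => by ring
  rw [gegenbauerIntegral_add hlam (by fun_prop) (by fun_prop)] at h₂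
  rw [h₁]
  field_simp
  linarith

theorem gegenbauerIntegral_one : ∀ d : ℕ,
    gegenbauerIntegral (((d : ℝ) + 1) / 2) (fun _ => 1) = Nsq (((d : ℝ) + 1) / 2) 0
  | 0 => by
    have : Real.Gamma (1 / 2) ^ 2 = π := by
      rw [Real.Gamma_one_half_eq, Real.sq_sqrt pi_pos.le]
    norm_num [gegenbauerIntegral, Nsq, this]
    field_simp
  | 1 => by
    have h : gegenbauerIntegral 1 (fun _ => 1) = π / 2 := by
      rw [← integral_sqrt_one_sub_sq]
      unfold gegenbauerIntegral
      congr 1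
      funext t
      rw [Real.sqrt_eq_rpow]
      norm_num
    norm_num [h, Nsq]
  | d + 2 => by
    have hd : (1 : ℝ) / 2 ≤ ((d : ℝ) + 1) / 2 := by
      have : (0 : ℝ) ≤ d := by positivity
      linarith
    have : (((d + 2 : ℕ) : ℝ) + 1) / 2 = ((d : ℝ) + 1) / 2 + 1 := by push_cast; ring
    rw [this, gegenbauerIntegral_one_add_one hd, Nsq_add_one_zero (by positivity),
      gegenbauerIntegral_one d]

theorem gegenbauerIntegral_mul (d m n : ℕ) (hlam : lam = ((d : ℝ) + 1) / 2) :
    gegenbauerIntegral lam (fun t => gegenbauer lam m t * gegenbauer lam n t) =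
      if m = n then Nsq lam m else 0 := by
  have hd : 1 / 2 ≤ lam := by
    have : (0 : ℝ) ≤ d := by positivity
    linarith
  rcases lt_trichotomy m n with h | rfl | h
  · rw [if_neg h.ne, gegenbauerIntegral_mul_of_lt hd m n h]
  · rw [if_pos rfl]
    induction m with
    | zero => simpa [gegenbauer_zero, hlam] using gegenbauerIntegral_one d
    | succ m ih =>
      rw [gegenbauerIntegral_mul_self_succ hd, ih, Nsq_succ (by linarith)]
  · rw [if_neg h.ne', ← gegenbauerIntegral_mul_of_lt hd n m h]
    simp only [mul_comm]

end Gegenbauer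

section Ball

/-- The homogenized Gegenbauer polynomial `a^(j/2) C_j^λ(z/√a)`. -/
noncomputable def gegenbauerScaled (lam : ℝ) (j : ℕ) (a z : ℝ) : ℝ :=
  a ^ ((j : ℝ) / 2) * gegenbauer lam j (z / √a)

theorem gegenbauerScaled_one (lam : ℝ) (j : ℕ) (z : ℝ) :
    gegenbauerScaled lam j 1 z = gegenbauer lam j z := by
  simp [gegenbauerScaled]

theorem Q3_eq (n j k : ℕ) (x y z : ℝ) :
    Q3 n j k x y z = (1 / h3 j k n) *
      (gegenbauer ((j : ℝ) + (k : ℝ) + 3 / 2) (n - j - k) x *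
        gegenbauerScaled ((k : ℝ) + 1) j (1 - x ^ 2) y *
        gegenbauerScaled (1 / 2) k (1 - x ^ 2 - y ^ 2) z) := by
  unfold Q3 gegenbauerScaled
  ring

theorem setIntegral_gegenbauerScaled_mul {lam : ℝ} (d j j' : ℕ) (hlam : lam = ((d : ℝ) + 1) / 2)
    {a : ℝ} (ha : 0 < a) :
    ∫ z in Set.Ioo (-√a) √a, (a - z ^ 2) ^ (lam - 1 / 2) *
        (gegenbauerScaled lam j a z * gegenbauerScaled lam j' a z) =
      if j = j' then Nsq lam j * a ^ ((j : ℝ) + lam) else 0 := by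
  have hs : 0 < √a := Real.sqrt_pos.2 ha
  have hss : √a ^ 2 = a := Real.sq_sqrt ha.le
  rw [← integral_Ioc_eq_integral_Ioo, ← intervalIntegral.integral_of_le (by linarith)]
  have hcongr : ∫ z in (-√a)..√a, (a - z ^ 2) ^ (lam - 1 / 2) *
        (gegenbauerScaled lam j a z * gegenbauerScaled lam j' a z) =
      ∫ z in (-√a)..√a, a ^ (lam - 1 / 2 + j / 2 + j' / 2) *
        (fun t => (1 - t ^ 2) ^ (lam - 1 / 2) * (gegenbauer lam j t * gegenbauer lam j' t))
          (z / √a) := by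
    apply intervalIntegral.integral_congr
    intro z hz
    rw [Set.uIcc_of_le (by linarith)] at hz
    have hz' : z ^ 2 ≤ a := by rw [← hss]; exact sq_le_sq' hz.1 hz.2
    have h1 : a - z ^ 2 = a * (1 - (z / √a) ^ 2) := by
      rw [div_pow, hss]
      field_simp
    have h0 : 0 ≤ 1 - (z / √a) ^ 2 := by
      rw [div_pow, hss, sub_nonneg]
      exact div_le_one_of_le₀ hz' ha.le
    simp only [gegenbauerScaled]
    rw [h1, Real.mul_rpow ha.le h0, Real.rpow_add ha, Real.rpow_add ha]
    ring
  rw [hcongr, intervalIntegral.integral_const_mul, intervalIntegral.integral_comp_div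
      (fun t => (1 - t ^ 2) ^ (lam - 1 / 2) * (gegenbauer lam j t * gegenbauer lam j' t)) hs.ne',
    neg_div, div_self hs.ne']
  change _ * (√a • gegenbauerIntegral lam
    (fun t => gegenbauer lam j t * gegenbauer lam j' t)) = _
  rw [gegenbauerIntegral_mul d j j' hlam]
  split_ifs with h
  · subst h
    rw [show (j : ℝ) + lam = lam - 1 / 2 + j / 2 + j / 2 + 1 / 2 by ring,
      Real.rpow_add ha (lam - 1 / 2 + j / 2 + j / 2), ← Real.sqrt_eq_rpow, smul_eq_mul]
    ring
  · simp

theorem exists_abs_gegenbauerScaled_le (lam : ℝ) (j : ℕ) :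
    ∃ M, ∀ a z, 0 ≤ a → a ≤ 1 → z ^ 2 ≤ a → |gegenbauerScaled lam j a z| ≤ M := by
  obtain ⟨M, hM⟩ := (isCompact_Icc (a := (-1 : ℝ)) (b := 1)).exists_bound_of_continuousOn
    (continuous_gegenbauer lam j).continuousOn
  refine ⟨M, fun a z h0 h1 hz => ?_⟩
  have ht : |z / √a| ≤ 1 := by
    rw [abs_div, abs_of_nonneg (Real.sqrt_nonneg a)]
    exact div_le_one_of_le₀ (Real.abs_le_sqrt hz) (Real.sqrt_nonneg a)
  have h := hM _ (abs_le.1 ht)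
  rw [Real.norm_eq_abs] at h
  have hr := Real.rpow_nonneg h0 ((j : ℝ) / 2)
  rw [gegenbauerScaled, abs_mul, abs_of_nonneg hr]
  calc _ ≤ 1 * M := mul_le_mul (Real.rpow_le_one h0 h1 (by positivity)) h (abs_nonneg _) zero_le_one
    _ = M := one_mul M

theorem measurable_gegenbauerScaled (lam : ℝ) (j : ℕ) :
    Measurable fun p : ℝ × ℝ => gegenbauerScaled lam j p.1 p.2 := by
  have := (continuous_gegenbauer lam j).measurable
  unfold gegenbauerScaled
  fun_prop

theorem measurableSet_unitBall3 : MeasurableSet unitBall3 :=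
  measurableSet_lt (by fun_prop) measurable_const

theorem volume_unitBall3_lt_top : volume unitBall3 < ⊤ := by
  refine (measure_mono (t := Metric.closedBall 0 1) ?_).trans_lt measure_closedBall_lt_top
  intro p hp
  have h : p.1 ^ 2 + p.2.1 ^ 2 + p.2.2 ^ 2 < 1 := hp
  rw [mem_closedBall_zero_iff, Prod.norm_def, Prod.norm_def, max_le_iff, max_le_iff]
  simp only [Real.norm_eq_abs]
  refine ⟨abs_le_one_iff_mul_self_le_one.2 ?_, abs_le_one_iff_mul_self_le_one.2 ?_,
    abs_le_one_iff_mul_self_le_one.2 ?_⟩ <;>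
  nlinarith [sq_nonneg p.1, sq_nonneg p.2.1, sq_nonneg p.2.2]

theorem measurable_Q3 (n j k : ℕ) :
    Measurable fun p : ℝ × ℝ × ℝ => Q3 n j k p.1 p.2.1 p.2.2 := by
  simp only [Q3_eq]
  have h₁ := (continuous_gegenbauer ((j : ℝ) + (k : ℝ) + 3 / 2) (n - j - k)).measurable
  have h₂ : Measurable fun p : ℝ × ℝ × ℝ =>
      gegenbauerScaled ((k : ℝ) + 1) j (1 - p.1 ^ 2) p.2.1 :=
    (measurable_gegenbauerScaled _ j).comp
      (g := fun p : ℝ × ℝ => gegenbauerScaled ((k : ℝ) + 1) j p.1 p.2)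
      (f := fun p : ℝ × ℝ × ℝ => (1 - p.1 ^ 2, p.2.1)) (by fun_prop)
  have h₃ : Measurable fun p : ℝ × ℝ × ℝ =>
      gegenbauerScaled (1 / 2) k (1 - p.1 ^ 2 - p.2.1 ^ 2) p.2.2 :=
    (measurable_gegenbauerScaled _ k).comp
      (g := fun p : ℝ × ℝ => gegenbauerScaled (1 / 2) k p.1 p.2)
      (f := fun p : ℝ × ℝ × ℝ => (1 - p.1 ^ 2 - p.2.1 ^ 2, p.2.2)) (by fun_prop)
  fun_prop

theorem exists_abs_Q3_le (n j k : ℕ) :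
    ∃ M, ∀ p ∈ unitBall3, |Q3 n j k p.1 p.2.1 p.2.2| ≤ M := by
  obtain ⟨M₁, h₁⟩ := exists_abs_gegenbauerScaled_le ((j : ℝ) + (k : ℝ) + 3 / 2) (n - j - k)
  obtain ⟨M₂, h₂⟩ := exists_abs_gegenbauerScaled_le ((k : ℝ) + 1) j
  obtain ⟨M₃, h₃⟩ := exists_abs_gegenbauerScaled_le (1 / 2) k
  refine ⟨|1 / h3 j k n| * (M₁ * M₂ * M₃), fun p hp => ?_⟩
  have h : p.1 ^ 2 + p.2.1 ^ 2 + p.2.2 ^ 2 < 1 := hp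
  have hx := sq_nonneg p.1
  have hy := sq_nonneg p.2.1
  have hz := sq_nonneg p.2.2
  rw [Q3_eq, ← gegenbauerScaled_one, abs_mul, abs_mul, abs_mul]
  have b₁ := h₁ 1 p.1 (by linarith) (by linarith) (by linarith)
  have b₂ := h₂ (1 - p.1 ^ 2) p.2.1 (by linarith) (by linarith) (by linarith)
  have b₃ := h₃ (1 - p.1 ^ 2 - p.2.1 ^ 2) p.2.2 (by linarith) (by linarith) (by linarith)
  have hM₁ := (abs_nonneg _).trans b₁
  have hM₂ := (abs_nonneg _).trans b₂
  gcongr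

theorem integrableOn_Q3_mul_Q3 (n m j k j' k' : ℕ) :
    IntegrableOn (fun p : ℝ × ℝ × ℝ => Q3 n j k p.1 p.2.1 p.2.2 * Q3 m j' k' p.1 p.2.1 p.2.2)
      unitBall3 := by
  obtain ⟨M, hM⟩ := exists_abs_Q3_le n j k
  obtain ⟨M', hM'⟩ := exists_abs_Q3_le m j' k'
  refine Measure.integrableOn_of_bounded (M := M * M') volume_unitBall3_lt_top.ne
    ((measurable_Q3 n j k).mul (measurable_Q3 m j' k')).aestronglyMeasurable ?_
  refine (ae_restrict_iff' measurableSet_unitBall3).2 (Eventually.of_forall fun p hp => ?_)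
  rw [Real.norm_eq_abs, abs_mul]
  exact mul_le_mul (hM p hp) (hM' p hp) (abs_nonneg _) ((abs_nonneg _).trans (hM p hp))

theorem mem_Ioo_sqrt_iff {a t : ℝ} : t ∈ Set.Ioo (-√a) √a ↔ t ^ 2 < a := by
  rw [Set.mem_Ioo, ← abs_lt, Real.lt_sqrt (abs_nonneg t), sq_abs]

/-- Fubini's theorem on the unit ball. -/
theorem setIntegral_unitBall3 {F : ℝ × ℝ × ℝ → ℝ} (hF : IntegrableOn F unitBall3) :
    ∫ p in unitBall3, F p = ∫ x in Set.Ioo (-√1) √1, ∫ y in Set.Ioo (-√(1 - x ^ 2)) √(1 - x ^ 2),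
      ∫ z in Set.Ioo (-√(1 - x ^ 2 - y ^ 2)) √(1 - x ^ 2 - y ^ 2), F (x, y, z) := by
  have hI : Integrable (unitBall3.indicator F) := hF.integrable_indicator measurableSet_unitBall3
  rw [← integral_indicator measurableSet_unitBall3, Measure.volume_eq_prod, integral_prod _ hI,
    ← integral_indicator measurableSet_Ioo]
  apply integral_congr_ae
  filter_upwards [hI.prod_right_ae] with x hx
  rw [Measure.volume_eq_prod, integral_prod _ hx]
  have hxyz (y z : ℝ) : (x, y, z) ∈ unitBall3 ↔ x ^ 2 + y ^ 2 + z ^ 2 < 1 := Iff.rfl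
  by_cases hx1 : x ∈ Set.Ioo (-√1) √1
  · rw [Set.indicator_of_mem hx1, ← integral_indicator measurableSet_Ioo]
    congr 1
    funext y
    by_cases hy : y ∈ Set.Ioo (-√(1 - x ^ 2)) √(1 - x ^ 2)
    · rw [Set.indicator_of_mem hy, ← integral_indicator measurableSet_Ioo]
      congr 1
      funext z
      simp only [Set.indicator, hxyz, mem_Ioo_sqrt_iff]
      congr 1
      apply propext
      constructor <;> intro h <;> linarith
    · rw [Set.indicator_of_notMem hy]
      rw [mem_Ioo_sqrt_iff] at hy
      refine integral_eq_zero_of_ae (Eventually.of_forall fun z => ?_)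
      refine Set.indicator_of_notMem (fun h => hy ?_) _
      rw [hxyz] at h
      linarith [sq_nonneg z]
  · rw [Set.indicator_of_notMem hx1]
    rw [mem_Ioo_sqrt_iff] at hx1
    refine integral_eq_zero_of_ae (Eventually.of_forall fun y => ?_)
    refine integral_eq_zero_of_ae (Eventually.of_forall fun z => ?_)
    refine Set.indicator_of_notMem (fun h => hx1 ?_) _
    rw [hxyz] at h
    linarith [sq_nonneg z, sq_nonneg y]

theorem h3_pos (j k n : ℕ) : 0 < h3 j k n :=
  Real.sqrt_pos.2 (mul_pos (mul_pos (Nsq_pos (by norm_num) k) (Nsq_pos (by positivity) j))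
    (Nsq_pos (by positivity) _))

theorem h3_mul_self (j k n : ℕ) : h3 j k n * h3 j k n =
    Nsq (1 / 2) k * Nsq ((k : ℝ) + 1) j * Nsq ((j : ℝ) + (k : ℝ) + 3 / 2) (n - j - k) :=
  Real.mul_self_sqrt (Real.sqrt_pos.1 (h3_pos j k n)).le

theorem setIntegral_Q3_mul_Q3_last (n m j k j' k' : ℕ) {x y : ℝ} (h : 0 < 1 - x ^ 2 - y ^ 2) :
    ∫ z in Set.Ioo (-√(1 - x ^ 2 - y ^ 2)) √(1 - x ^ 2 - y ^ 2),
      Q3 n j k x y z * Q3 m j' k' x y z =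
    1 / (h3 j k n * h3 j' k' m) *
      (gegenbauer ((j : ℝ) + k + 3 / 2) (n - j - k) x *
        gegenbauer ((j' : ℝ) + k' + 3 / 2) (m - j' - k') x) *
      (gegenbauerScaled ((k : ℝ) + 1) j (1 - x ^ 2) y *
        gegenbauerScaled ((k' : ℝ) + 1) j' (1 - x ^ 2) y) *
      if k = k' then Nsq (1 / 2) k * (1 - x ^ 2 - y ^ 2) ^ ((k : ℝ) + 1 / 2) else 0 := by
  rw [← setIntegral_gegenbauerScaled_mul 0 k k' (by norm_num) h, ← integral_const_mul]
  congr 1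
  funext z
  rw [Q3_eq, Q3_eq]
  simp only [sub_self, Real.rpow_zero]
  ring

theorem setIntegral_Q3_mul_Q3_last_two (n m j k j' k' : ℕ) {x : ℝ} (h : 0 < 1 - x ^ 2) :
    ∫ y in Set.Ioo (-√(1 - x ^ 2)) √(1 - x ^ 2),
      ∫ z in Set.Ioo (-√(1 - x ^ 2 - y ^ 2)) √(1 - x ^ 2 - y ^ 2),
        Q3 n j k x y z * Q3 m j' k' x y z =
    1 / (h3 j k n * h3 j' k' m) *
      (gegenbauer ((j : ℝ) + k + 3 / 2) (n - j - k) x *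
        gegenbauer ((j' : ℝ) + k' + 3 / 2) (m - j' - k') x) *
      if k = k' ∧ j = j' then
        Nsq (1 / 2) k * Nsq ((k : ℝ) + 1) j * (1 - x ^ 2) ^ ((j : ℝ) + (k + 1)) else 0 := by
  rw [setIntegral_congr_fun measurableSet_Ioo fun y hy => setIntegral_Q3_mul_Q3_last n m j k j' k'
    (sub_pos.2 (mem_Ioo_sqrt_iff.1 hy))]
  by_cases hk : k = k'
  · subst hk
    have hj := setIntegral_gegenbauerScaled_mul (lam := (k : ℝ) + 1) (2 * k + 1) j j'
      (by push_cast; ring) h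
    have : (if j = j' then Nsq (1 / 2) k * Nsq ((k : ℝ) + 1) j *
        (1 - x ^ 2) ^ ((j : ℝ) + (k + 1)) else 0) = Nsq (1 / 2) k *
        if j = j' then Nsq ((k : ℝ) + 1) j * (1 - x ^ 2) ^ ((j : ℝ) + (k + 1)) else 0 := by
      split_ifs <;> ring
    simp only [true_and, if_true]
    rw [this, ← hj, ← integral_const_mul, ← integral_const_mul]
    congr 1
    funext y
    rw [show (k : ℝ) + 1 - 1 / 2 = k + 1 / 2 by ring]
    ring
  · simp [hk]

end Ball

/-- the `Q_n^{j,k}` form an orthonormal family in `L²(𝔹₃)`. -/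
theorem Q3_orthonormal (n m j k j' k' : ℕ) (hjk : j + k ≤ n) (hjk' : j' + k' ≤ m) :
    (∫ p in unitBall3, Q3 n j k p.1 p.2.1 p.2.2 * Q3 m j' k' p.1 p.2.1 p.2.2) =
      if (n, j, k) = (m, j', k') then (1 : ℝ) else 0 := by
  rw [setIntegral_unitBall3 (integrableOn_Q3_mul_Q3 n m j k j' k')]
  rw [setIntegral_congr_fun measurableSet_Ioo fun x hx =>
    setIntegral_Q3_mul_Q3_last_two n m j k j' k' (sub_pos.2 (mem_Ioo_sqrt_iff.1 hx))]
  by_cases h : k = k' ∧ j = j'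
  · obtain ⟨rfl, rfl⟩ := h
    have hx := setIntegral_gegenbauerScaled_mul (lam := (j : ℝ) + k + 3 / 2)
      (2 * (j + k + 1)) (n - j - k) (m - j - k) (by push_cast; ring) one_pos
    simp only [gegenbauerScaled_one, Real.one_rpow, mul_one] at hx
    have hcongr : ∀ x : ℝ, 1 / (h3 j k n * h3 j k m) *
        (gegenbauer ((j : ℝ) + k + 3 / 2) (n - j - k) x *
          gegenbauer ((j : ℝ) + k + 3 / 2) (m - j - k) x) *
        (Nsq (1 / 2) k * Nsq ((k : ℝ) + 1) j * (1 - x ^ 2) ^ ((j : ℝ) + (k + 1))) =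
        1 / (h3 j k n * h3 j k m) * (Nsq (1 / 2) k * Nsq ((k : ℝ) + 1) j) *
        ((1 - x ^ 2) ^ ((j : ℝ) + k + 3 / 2 - 1 / 2) *
          (gegenbauer ((j : ℝ) + k + 3 / 2) (n - j - k) x *
            gegenbauer ((j : ℝ) + k + 3 / 2) (m - j - k) x)) := by
      intro x
      rw [show (j : ℝ) + k + 3 / 2 - 1 / 2 = j + (k + 1) by ring]
      ring
    simp only [and_self, if_true, hcongr]
    rw [integral_const_mul, hx]
    by_cases hnm : n = m
    · subst hnm
      simp only [if_true]
      have hpos := mul_pos (h3_pos j k n) (h3_pos j k n)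
      rw [mul_assoc, ← h3_mul_self, one_div_mul_cancel hpos.ne']
    · rw [if_neg (by omega), if_neg (by simp [hnm]), mul_zero]
  · have h' : (n, j, k) ≠ (m, j', k') := by
      simp only [ne_eq, Prod.mk.injEq, not_and]
      tauto
    simp [h, h']
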